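/- Let X be a Banach space whose norm satisfies δ_X(ε) ≥ c·ε^q for some c > 0 and q ∈ [2,∞), where δ_X is the modulus of convexity. Then there exists a constant c₁ > 0 (depending only on c and q) such that for every n ≥ 2 and every map φ : T_n → X satisfying d(u,v) ≤ ‖φ(u) − φ(v)‖ ≤ D·d(u,v) for all u,v ∈ T_n, one has D ≥ c₁·(log₂ n)^{1/q}. -/

import Mathlib

noncomputable section

/-- The length of the longest common initial segment of two `{0,1}`-sequences. -/
def lcp : List Bool → List Bool → ℕ
  | a :: s, b :: t => if a = b then lcp s t + 1 else 0
  | _, _ => 0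

/-- The tree distance `d(s,t) = |s| + |t| − 2ℓ(s,t)` on finite `{0,1}`-sequences. -/
def treeDist (s t : List Bool) : ℝ :=
  (s.length : ℝ) + (t.length : ℝ) - 2 * (lcp s t : ℝ)

/-- The binary tree of depth `n`: all `{0,1}`-sequences of length at most `n`. -/
def BinTree (n : ℕ) := {l : List Bool // l.length ≤ n}

theorem lcp_append (p s t : List Bool) : lcp (p ++ s) (p ++ t) = p.length + lcp s t := by
  induction p with
  | nil => simp
  | cons a p ih => simp only [List.cons_append, lcp, if_true, ih, List.length_cons]; omega

theorem treeDist_append (p s t : List Bool) : treeDist (p ++ s) (p ++ t) = treeDist s t := by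
  simp only [treeDist, lcp_append, List.length_append]
  push_cast
  ring

theorem treeDist_child (s : List Bool) (b : Bool) : treeDist (s ++ [b]) s = 1 := by
  have h := treeDist_append s [b] []
  rw [List.append_nil] at h
  rw [h]
  simp [treeDist, lcp]

theorem treeDist_cousins (s : List Bool) (b : Bool) :
    treeDist (s ++ [b, true]) (s ++ [b, false]) = 2 := by
  rw [treeDist_append]
  norm_num [treeDist, lcp]

/-- The sequence obtained from `s` by inserting after each term a further term, which `c` selects
from the initial segment constructed so far and the term of `s` just appended. -/
def interleave : (List Bool → Bool → Bool) → List Bool → List Bool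
  | _, [] => []
  | c, b :: s => b :: c [] b :: interleave (fun u => c (b :: c [] b :: u)) s

theorem length_interleave (c : List Bool → Bool → Bool) (s : List Bool) :
    (interleave c s).length = 2 * s.length := by
  induction s generalizing c with
  | nil => rfl
  | cons b s ih => simp only [interleave, List.length_cons, ih]; omega

theorem interleave_concat (c : List Bool → Bool → Bool) (s : List Bool) (b : Bool) :
    interleave c (s ++ [b]) = interleave c s ++ [b, c (interleave c s) b] := by
  induction s generalizing c with
  | nil => rfl
  | cons a s ih => simp only [List.cons_append, interleave, ih]

theorem lcp_interleave (c : List Bool → Bool → Bool) (s t : List Bool) :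
    lcp (interleave c s) (interleave c t) = 2 * lcp s t := by
  induction s generalizing c t with
  | nil => simp [interleave, lcp]
  | cons a s ih =>
    cases t with
    | nil => simp [interleave, lcp]
    | cons b t =>
      by_cases h : a = b
      · subst h
        simp only [interleave, lcp, if_true, ih]
        omega
      · simp [interleave, lcp, h]

theorem treeDist_interleave (c : List Bool → Bool → Bool) (s t : List Bool) :
    treeDist (interleave c s) (interleave c t) = 2 * treeDist s t := by
  simp only [treeDist, lcp_interleave, length_interleave]
  push_cast
  ring

/-- The modulus of convexity of `X` is at least `c * ε ^ q`. -/
def ModulusOfConvexityGE (X : Type*) [NormedAddCommGroup X] [NormedSpace ℝ X] (c q : ℝ) : Prop :=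
  ∀ x y : X, ‖x‖ = 1 → ‖y‖ = 1 → ∀ ε : ℝ, 0 < ε → ε ≤ 2 → ε ≤ ‖x - y‖ →
    ‖(2⁻¹ : ℝ) • (x + y)‖ ≤ 1 - c * ε ^ q

section Convexity

variable {X : Type*} [NormedAddCommGroup X] [NormedSpace ℝ X] {c q : ℝ}

theorem ModulusOfConvexityGE.norm_add_le_of_norm_le_norm (hX : ModulusOfConvexityGE X c q)
    (hc : 0 < c) (hq : 1 ≤ q) {a b : X} {ε : ℝ} (ha : ‖a‖ ≤ 1) (hba : ‖b‖ ≤ ‖a‖)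
    (hε : 0 < ε) (hε' : ε ≤ 2) (hab : ε ≤ ‖a - b‖) :
    ‖a + b‖ ≤ 2 * (1 - min (1 / 4) (c / 2) * (ε / 2) ^ q) := by
  have hpow : 0 ≤ (ε / 2) ^ q := by positivity
  have hpow' : (ε / 2) ^ q ≤ ε / 2 := by
    simpa using Real.rpow_le_rpow_of_exponent_ge (by positivity) (by linarith : ε / 2 ≤ 1) hq
  rcases lt_or_ge ‖b‖ (1 - ε / 4) with hb | hb
  · have h := mul_le_mul_of_nonneg_right (min_le_left (1 / 4) (c / 2)) hpow
    linarith [norm_add_le a b]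
  · have hb0 : 1 / 2 ≤ ‖b‖ := by linarith
    have hbpos : 0 < ‖b‖ := by linarith
    have hapos : 0 < ‖a‖ := by linarith
    obtain ⟨x, hx1, hx⟩ : ∃ x : X, ‖x‖ = 1 ∧ a = ‖a‖ • x :=
      ⟨‖a‖⁻¹ • a, by rw [norm_smul, norm_inv, norm_norm, inv_mul_cancel₀ hapos.ne'],
        by rw [smul_smul, mul_inv_cancel₀ hapos.ne', one_smul]⟩
    obtain ⟨y, hy1, hy⟩ : ∃ y : X, ‖y‖ = 1 ∧ b = ‖b‖ • y :=
      ⟨‖b‖⁻¹ • b, by rw [norm_smul, norm_inv, norm_norm, inv_mul_cancel₀ hbpos.ne'],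
        by rw [smul_smul, mul_inv_cancel₀ hbpos.ne', one_smul]⟩
    generalize ‖a‖ = α at *
    generalize ‖b‖ = β at *
    subst hx hy
    have hxy : ε / 2 ≤ ‖x - y‖ := by
      have h : α • x - β • y = (x - y) - (1 - α) • x + (1 - β) • y := by module
      have h1 : ‖(1 - α) • x‖ = 1 - α := by
        rw [norm_smul, hx1, mul_one, Real.norm_of_nonneg (by linarith)]
      have h2 : ‖(1 - β) • y‖ = 1 - β := by
        rw [norm_smul, hy1, mul_one, Real.norm_of_nonneg (by linarith)]
      rw [h] at hab
      linarith [norm_add_le ((x - y) - (1 - α) • x) ((1 - β) • y),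
        norm_sub_le (x - y) ((1 - α) • x)]
    have hconv := hX x y hx1 hy1 (ε / 2) (by positivity) (by linarith) hxy
    rw [norm_smul, Real.norm_of_nonneg (by norm_num)] at hconv
    have hsum : ‖α • x + β • y‖ ≤ β * ‖x + y‖ + (α - β) := by
      have h : α • x + β • y = β • (x + y) + (α - β) • x := by module
      rw [h]
      refine (norm_add_le _ _).trans (le_of_eq ?_)
      rw [norm_smul, norm_smul, hx1, mul_one, Real.norm_of_nonneg hbpos.le,
        Real.norm_of_nonneg (by linarith)]
    have hcp : 0 ≤ c * (ε / 2) ^ q := by positivity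
    have h3 := mul_le_mul_of_nonneg_right (min_le_right (1 / 4) (c / 2)) hpow
    nlinarith [mul_le_mul_of_nonneg_left hconv hbpos.le, mul_le_mul_of_nonneg_right hb0 hcp]

theorem ModulusOfConvexityGE.norm_add_le (hX : ModulusOfConvexityGE X c q)
    (hc : 0 < c) (hq : 1 ≤ q) {a b : X} {ε : ℝ} (ha : ‖a‖ ≤ 1) (hb : ‖b‖ ≤ 1)
    (hε : 0 < ε) (hε' : ε ≤ 2) (hab : ε ≤ ‖a - b‖) :
    ‖a + b‖ ≤ 2 * (1 - min (1 / 4) (c / 2) * (ε / 2) ^ q) := by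
  rcases le_total ‖b‖ ‖a‖ with h | h
  · exact hX.norm_add_le_of_norm_le_norm hc hq ha h hε hε' hab
  · rw [add_comm]
    exact hX.norm_add_le_of_norm_le_norm hc hq hb h hε hε' (by rwa [norm_sub_rev])

/-- The constant in the bound on the length of the shorter prong of a fork. -/
def forkConst (c q : ℝ) : ℝ := min (1 / 4) (c / 2) * (1 / 2) ^ q

theorem forkConst_pos (hc : 0 < c) : 0 < forkConst c q := by
  have : 0 < min (1 / 4) (c / 2) := lt_min (by norm_num) (by positivity)
  unfold forkConst
  positivity

theorem ModulusOfConvexityGE.norm_add_le_of_one_le_norm_sub (hX : ModulusOfConvexityGE X c q)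
    (hc : 0 < c) (hq : 1 ≤ q) {a b : X} {L : ℝ} (hL : 1 ≤ L) (ha : ‖a‖ ≤ L) (hb : ‖b‖ ≤ L)
    (hab : 1 ≤ ‖a - b‖) : ‖a + b‖ ≤ 2 * (L - forkConst c q * L ^ (1 - q)) := by
  have hL0 : 0 < L := by linarith
  have hscale (x : X) : ‖L⁻¹ • x‖ = ‖x‖ / L := by
    rw [norm_smul, norm_inv, Real.norm_of_nonneg hL0.le]; ring
  have h := hX.norm_add_le hc hq (a := L⁻¹ • a) (b := L⁻¹ • b) (ε := 1 / L)
    (by rw [hscale]; exact (div_le_one hL0).2 ha) (by rw [hscale]; exact (div_le_one hL0).2 hb)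
    (by positivity) (((div_le_one hL0).2 hL).trans one_le_two)
    (by rw [← smul_sub, hscale]; gcongr)
  rw [← smul_add, hscale, div_le_iff₀ hL0] at h
  refine h.trans (le_of_eq ?_)
  rw [forkConst, show (1 / L / 2 : ℝ) = 1 / 2 * L⁻¹ by ring,
    Real.mul_rpow (by norm_num) (by positivity), Real.inv_rpow hL0.le, Real.rpow_sub hL0,
    Real.rpow_one]
  ring

theorem ModulusOfConvexityGE.fork (hX : ModulusOfConvexityGE X c q) (hc : 0 < c) (hq : 1 ≤ q)
    {x₀ x₁ x₂ x₂' : X} {L : ℝ} (hL : 1 ≤ L) (h₁ : ‖x₁ - x₀‖ ≤ L) (h₂ : ‖x₂ - x₁‖ ≤ L)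
    (h₂' : ‖x₂' - x₁‖ ≤ L) (h : 2 ≤ ‖x₂ - x₂'‖) :
    ‖x₂ - x₀‖ ≤ 2 * (L - forkConst c q * L ^ (1 - q)) ∨
      ‖x₂' - x₀‖ ≤ 2 * (L - forkConst c q * L ^ (1 - q)) := by
  rcases le_or_gt 1 ‖(x₂ - x₁) - (x₁ - x₀)‖ with h' | h'
  · left
    simpa using hX.norm_add_le_of_one_le_norm_sub hc hq hL h₂ h₁ h'
  · right
    have hfar : 1 ≤ ‖(x₂' - x₁) - (x₁ - x₀)‖ := by
      have := norm_sub_le ((x₂ - x₁) - (x₁ - x₀)) ((x₂' - x₁) - (x₁ - x₀))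
      rw [show (x₂ - x₁) - (x₁ - x₀) - ((x₂' - x₁) - (x₁ - x₀)) = x₂ - x₂' by abel] at this
      linarith
    simpa using hX.norm_add_le_of_one_le_norm_sub hc hq hL h₂' h₁ hfar

/-- A noncontracting map from the tree of depth `2 ^ k` whose Lipschitz constant is at most `D`
has Lipschitz constant at least `1 + k * K * D ^ (1 - q)`. -/
theorem ModulusOfConvexityGE.lipschitz_lower_bound (hX : ModulusOfConvexityGE X c q)
    (hc : 0 < c) (hq : 1 ≤ q) {D : ℝ} (k : ℕ) (φ : List Bool → X) {L : ℝ} (hLD : L ≤ D)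
    (hlower : ∀ u v : List Bool, u.length ≤ 2 ^ k → v.length ≤ 2 ^ k →
      treeDist u v ≤ ‖φ u - φ v‖)
    (hupper : ∀ (u : List Bool) (b : Bool), u.length + 1 ≤ 2 ^ k → ‖φ (u ++ [b]) - φ u‖ ≤ L) :
    1 + k * (forkConst c q * D ^ (1 - q)) ≤ L := by
  have hL1 : 1 ≤ L := by
    have h1 : 1 ≤ 2 ^ k := Nat.one_le_two_pow
    have h := hlower ([] ++ [true]) [] (by simpa using h1) (by simp)
    rw [treeDist_child] at h
    exact h.trans (hupper [] true (by simpa using h1))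
  induction k generalizing φ L with
  | zero => simpa using hL1
  | succ k ih =>
    have hK := forkConst_pos (q := q) hc
    have hpow : D ^ (1 - q) ≤ L ^ (1 - q) :=
      Real.rpow_le_rpow_of_nonpos (by linarith) hLD (by linarith)
    set L' := L - forkConst c q * D ^ (1 - q) with hL'
    have hle : 2 * (L - forkConst c q * L ^ (1 - q)) ≤ 2 * L' := by
      have := mul_le_mul_of_nonneg_left hpow hK.le
      linarith
    have hchoice : ∀ (s : List Bool) (b : Bool), ∃ e : Bool, s.length + 2 ≤ 2 ^ (k + 1) →
        ‖φ (s ++ [b, e]) - φ s‖ ≤ 2 * L' := by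
      intro s b
      by_cases hs : s.length + 2 ≤ 2 ^ (k + 1)
      · have h2 (e : Bool) : ‖φ (s ++ [b, e]) - φ (s ++ [b])‖ ≤ L := by
          simpa using hupper (s ++ [b]) e (by simp; omega)
        have h22 := hlower (s ++ [b, true]) (s ++ [b, false]) (by simpa using hs)
          (by simpa using hs)
        rw [treeDist_cousins] at h22
        rcases hX.fork hc hq hL1 (hupper s b (by omega)) (h2 true) (h2 false) h22 with h | h
        · exact ⟨true, fun _ => h.trans hle⟩
        · exact ⟨false, fun _ => h.trans hle⟩
      · exact ⟨true, fun h => absurd h hs⟩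
    choose e he using hchoice
    have hhalf (x y : X) : ‖(2⁻¹ : ℝ) • x - (2⁻¹ : ℝ) • y‖ = ‖x - y‖ / 2 := by
      rw [← smul_sub, norm_smul, Real.norm_of_nonneg (by norm_num)]; ring
    have hlower' : ∀ u v : List Bool, u.length ≤ 2 ^ k → v.length ≤ 2 ^ k →
        treeDist u v ≤
          ‖(2⁻¹ : ℝ) • φ (interleave e u) - (2⁻¹ : ℝ) • φ (interleave e v)‖ := by
      intro u v hu hv
      have h := hlower (interleave e u) (interleave e v)
        (by rw [length_interleave, pow_succ]; omega) (by rw [length_interleave, pow_succ]; omega)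
      rw [treeDist_interleave] at h
      rw [hhalf]
      linarith
    have hupper' : ∀ (u : List Bool) (b : Bool), u.length + 1 ≤ 2 ^ k →
        ‖(2⁻¹ : ℝ) • φ (interleave e (u ++ [b])) - (2⁻¹ : ℝ) • φ (interleave e u)‖ ≤ L' := by
      intro u b hu
      rw [hhalf, interleave_concat]
      linarith [he (interleave e u) b (by rw [length_interleave, pow_succ]; omega)]
    have hL'D : L' ≤ D := by
      have : 0 ≤ D ^ (1 - q) := Real.rpow_nonneg (by linarith) _
      have := mul_nonneg hK.le this
      linarith
    have hL'1 : 1 ≤ L' := by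
      have h1 : 1 ≤ 2 ^ k := Nat.one_le_two_pow
      have h := hlower' ([] ++ [true]) [] (by simpa using h1) (by simp)
      rw [treeDist_child] at h
      exact h.trans (hupper' [] true (by simpa using h1))
    have h := ih (fun s => (2⁻¹ : ℝ) • φ (interleave e s)) hL'D hlower' hupper' hL'1
    push_cast
    linarith

end Convexity

/-- Lower bound for the distortion of embeddings of binary trees into a `q`-convex Banach
space: if `δ_X(ε) ≥ c ε^q`, then any embedding of `T_n` which is distance non-decreasing
and `D`-Lipschitz satisfies `D ≥ c₁ (log₂ n)^{1/q}`, with `c₁` depending only on `c, q`. -/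
theorem tree_distortion_lower_bound (c q : ℝ) (hc : 0 < c) (hq : 2 ≤ q) :
    ∃ c₁ : ℝ, 0 < c₁ ∧
      ∀ (X : Type) [NormedAddCommGroup X] [NormedSpace ℝ X] [CompleteSpace X],
        -- the modulus of convexity of `X` satisfies `δ_X(ε) ≥ c ε^q`:
        (∀ x y : X, ‖x‖ = 1 → ‖y‖ = 1 → ∀ ε : ℝ, 0 < ε → ε ≤ 2 → ε ≤ ‖x - y‖ →
            ‖(2⁻¹ : ℝ) • (x + y)‖ ≤ 1 - c * ε ^ q) →
        ∀ n : ℕ, 2 ≤ n → ∀ (D : ℝ) (φ : BinTree n → X),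
          (∀ u v : BinTree n,
              treeDist u.1 v.1 ≤ ‖φ u - φ v‖ ∧ ‖φ u - φ v‖ ≤ D * treeDist u.1 v.1) →
          c₁ * Real.logb 2 (n : ℝ) ^ (1 / q) ≤ D := by
  have hK := forkConst_pos (q := q) hc
  refine ⟨(forkConst c q / 2) ^ (1 / q), by positivity, ?_⟩
  intro X _ _ _ hX n hn D φ hφ
  have hk1 : 1 ≤ Nat.log 2 n := Nat.log_pos one_lt_two hn
  have hkn : 2 ^ Nat.log 2 n ≤ n := Nat.pow_log_le_self 2 (by omega)
  have hnk : n < 2 ^ (Nat.log 2 n + 1) := Nat.lt_pow_succ_log_self one_lt_two n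
  set k := Nat.log 2 n
  have hn0 : (0 : ℝ) < n := by exact_mod_cast (by omega : 0 < n)
  have hlog : Real.logb 2 n ≤ 2 * k := by
    have h : Real.logb 2 n ≤ ((k + 1 : ℕ) : ℝ) := by
      rw [Real.logb_le_iff_le_rpow one_lt_two hn0, Real.rpow_natCast]
      exact_mod_cast hnk.le
    have : (1 : ℝ) ≤ k := by exact_mod_cast hk1
    push_cast at h
    linarith
  have hlog0 : 0 ≤ Real.logb 2 n :=
    Real.logb_nonneg one_lt_two (by exact_mod_cast (by omega : 1 ≤ n))
  have hD1 : 1 ≤ D := by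
    have h := hφ ⟨[] ++ [true], by simp; omega⟩ ⟨[], by simp⟩
    simp only [treeDist_child, mul_one] at h
    exact h.1.trans h.2
  have hD0 : 0 < D := by linarith
  have hmain : 1 + k * (forkConst c q * D ^ (1 - q)) ≤ D := by
    refine ModulusOfConvexityGE.lipschitz_lower_bound hX hc (by linarith) k
      (fun l => if h : l.length ≤ n then φ ⟨l, h⟩ else 0) le_rfl ?_ ?_
    · intro u v hu hv
      simp only [hu.trans hkn, hv.trans hkn, dite_true]
      exact (hφ ⟨u, _⟩ ⟨v, _⟩).1
    · intro u b hu
      have hu' : (u ++ [b]).length ≤ n := by simpa using hu.trans hkn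
      have hu'' : u.length ≤ n := by omega
      simp only [hu', hu'', dite_true]
      have h := (hφ ⟨u ++ [b], hu'⟩ ⟨u, hu''⟩).2
      rwa [treeDist_child, mul_one] at h
  have hDq : forkConst c q / 2 * Real.logb 2 n ≤ D ^ q := by
    have hDq0 : 0 < D ^ q := by positivity
    have h : k * forkConst c q * (D / D ^ q) ≤ D := by
      rw [Real.rpow_sub hD0, Real.rpow_one] at hmain
      linarith
    rw [← mul_div_assoc, div_le_iff₀ hDq0, mul_comm D] at h
    have h' := le_of_mul_le_mul_right h hD0
    nlinarith
  rw [← Real.mul_rpow (by positivity) hlog0, one_div]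
  exact (Real.rpow_inv_le_iff_of_pos (by positivity) hD0.le (by linarith)).2 hDq
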